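/- Let s > 0 and σ > 0 be real constants. Let X₀ be an integrable real-valued random variable and let ε be a random variable with standard Gaussian law independent of X₀. Define Xₜ = s·X₀ + s·σ·ε and let pₜ(x) = ∫ φ(x; s·x₀, s²σ²) d(law of X₀)(x₀) be the density of Xₜ, where φ(·; m, v) denotes the Lebesgue density of the Gaussian with mean m and variance v. Then almost surely, E[(s·X₀ − Xₜ)/(s²σ²) | Xₜ] = (log pₜ)′(Xₜ); that is, the conditional expectation of the transition score ∇ₓ log p(Xₜ | X₀) given Xₜ equals the marginal score ∇ log pₜ at Xₜ. -/

import Mathlib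

open MeasureTheory ProbabilityTheory
open scoped NNReal

lemma hasDerivAt_gaussianPDFReal (m : ℝ) {v : ℝ≥0} (hv : v ≠ 0) (x : ℝ) :
    HasDerivAt (gaussianPDFReal m v) ((m - x) / v * gaussianPDFReal m v x) x := by
  have hv' : (v : ℝ) ≠ 0 := by exact_mod_cast hv
  have h : HasDerivAt (fun y : ℝ ↦ -(y - m) ^ 2 / (2 * v)) ((m - x) / v) x := by
    refine (((((hasDerivAt_id x).sub_const m).pow 2).neg).div_const (2 * (v : ℝ))).congr_deriv ?_
    simp only [id_eq]
    field_simp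
    ring
  rw [gaussianPDFReal_def]
  refine (h.exp.const_mul _).congr_deriv ?_
  ring

lemma gaussianPDFReal_le (m : ℝ) (v : ℝ≥0) (x : ℝ) :
    gaussianPDFReal m v x ≤ (√(2 * Real.pi * v))⁻¹ := by
  rw [gaussianPDFReal_def]
  refine mul_le_of_le_one_right (by positivity) (Real.exp_le_one_iff.2 ?_)
  rw [neg_div, neg_nonpos]
  positivity

lemma norm_score_mul_gaussianPDFReal_le (m : ℝ) {v : ℝ≥0} (hv : v ≠ 0) (x : ℝ) :
    ‖(m - x) / v * gaussianPDFReal m v x‖ ≤ (1 + v) / v * (√(2 * Real.pi * v))⁻¹ := by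
  have hv' : (0 : ℝ) < v := by exact_mod_cast pos_iff_ne_zero.2 hv
  set t : ℝ := (x - m) ^ 2 / (2 * v) with ht
  have ht0 : 0 ≤ t := by positivity
  have hmul : |m - x| ≤ (1 + v) * Real.exp t := by
    have h1 : t * (2 * v) = |m - x| ^ 2 := by
      rw [ht, div_mul_cancel₀ _ (by positivity), sq_abs]; ring
    have h2 := Real.add_one_le_exp t
    have h3 : |m - x| ≤ (1 + v) * (t + 1) := by
      have h4 : |m - x| * (2 * v) ≤ ((1 + v) * (t + 1)) * (2 * v) := by
        nlinarith [sq_nonneg (|m - x| - v), mul_nonneg hv'.le (sq_nonneg |m - x|)]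
      exact le_of_mul_le_mul_right h4 (by positivity)
    exact h3.trans (by gcongr)
  have hexp : |m - x| * Real.exp (-t) ≤ 1 + v := by
    rw [Real.exp_neg, ← div_eq_mul_inv, div_le_iff₀ (Real.exp_pos _)]
    exact hmul
  have heq : ‖(m - x) / v * gaussianPDFReal m v x‖
      = |m - x| * Real.exp (-t) / v * (√(2 * Real.pi * v))⁻¹ := by
    rw [norm_mul, norm_div, Real.norm_eq_abs, Real.norm_of_nonneg hv'.le,
      Real.norm_of_nonneg (gaussianPDFReal_nonneg m v x), gaussianPDFReal_def, ht, ← neg_div]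
    ring
  rw [heq]
  gcongr

section Mixture

variable {α : Type*} [MeasurableSpace α] (μ : Measure α)

lemma measurable_gaussianPDFReal_mean {m : α → ℝ} (hm : Measurable m) (v : ℝ≥0) (x : ℝ) :
    Measurable fun a ↦ gaussianPDFReal (m a) v x :=
  measurable_uncurry_gaussianPDFReal.comp
    (hm.prodMk (measurable_const.prodMk measurable_const))

variable [IsProbabilityMeasure μ]

lemma integrable_gaussianPDFReal_mean {m : α → ℝ} (hm : Measurable m) (v : ℝ≥0) (x : ℝ) :
    Integrable (fun a ↦ gaussianPDFReal (m a) v x) μ :=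
  .of_bound (measurable_gaussianPDFReal_mean hm v x).aestronglyMeasurable _
    (ae_of_all _ fun a ↦ (Real.norm_of_nonneg (gaussianPDFReal_nonneg _ _ _)).trans_le
      (gaussianPDFReal_le (m a) v x))

lemma integral_gaussianPDFReal_mean_pos {m : α → ℝ} (hm : Measurable m) {v : ℝ≥0} (hv : v ≠ 0)
    (x : ℝ) : 0 < ∫ a, gaussianPDFReal (m a) v x ∂μ := by
  rw [integral_pos_iff_support_of_nonneg (fun a ↦ gaussianPDFReal_nonneg _ _ _)
    (integrable_gaussianPDFReal_mean μ hm v x)]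
  have : (Function.support fun a ↦ gaussianPDFReal (m a) v x) = Set.univ :=
    Set.eq_univ_of_forall fun a ↦ (gaussianPDFReal_pos _ _ _ hv).ne'
  simp [this]

lemma hasDerivAt_integral_gaussianPDFReal_mean {m : α → ℝ} (hm : Measurable m) {v : ℝ≥0}
    (hv : v ≠ 0) (x : ℝ) :
    HasDerivAt (fun y ↦ ∫ a, gaussianPDFReal (m a) v y ∂μ)
      (∫ a, (m a - x) / v * gaussianPDFReal (m a) v x ∂μ) x :=
  (hasDerivAt_integral_of_dominated_loc_of_deriv_le Filter.univ_mem
    (.of_forall fun y ↦ (measurable_gaussianPDFReal_mean hm v y).aestronglyMeasurable)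
    (integrable_gaussianPDFReal_mean μ hm v x)
    (((hm.sub_const x).div_const (v : ℝ)).mul
      (measurable_gaussianPDFReal_mean hm v x)).aestronglyMeasurable
    (ae_of_all _ fun a y _ ↦ norm_score_mul_gaussianPDFReal_le (m a) hv y)
    (integrable_const _)
    (ae_of_all _ fun a y _ ↦ hasDerivAt_gaussianPDFReal (m a) hv y)).2

/-- The score of a Gaussian mixture, times its density, is the mixture of the scores of the
components times their densities. -/
lemma deriv_log_integral_gaussianPDFReal_mul {m : α → ℝ} (hm : Measurable m) {v : ℝ≥0}
    (hv : v ≠ 0) (x : ℝ) :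
    deriv (fun y ↦ Real.log (∫ a, gaussianPDFReal (m a) v y ∂μ)) x *
        ∫ a, gaussianPDFReal (m a) v x ∂μ
      = ∫ a, (m a - x) / v * gaussianPDFReal (m a) v x ∂μ := by
  have hpos := integral_gaussianPDFReal_mean_pos μ hm hv x
  rw [((hasDerivAt_integral_gaussianPDFReal_mean μ hm hv x).log hpos.ne').deriv,
    div_mul_cancel₀ _ hpos.ne']

end Mixture

/-- The joint law of `X` and its noisy observation `c X + d ε` has a density with respect to the
product of the law of `X` and the Lebesgue measure. -/
lemma map_prodMk_const_mul_add_gaussian {Ω : Type*} [MeasurableSpace Ω] {P : Measure Ω}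
    [IsProbabilityMeasure P] {X ε : Ω → ℝ} (hX : Measurable X) (hε : Measurable ε)
    (hεlaw : P.map ε = gaussianReal 0 1) (hindep : IndepFun X ε P) (c : ℝ) {d : ℝ} (hd : d ≠ 0) :
    P.map (fun ω ↦ (X ω, c * X ω + d * ε ω))
      = ((P.map X).prod volume).withDensity
        fun z ↦ gaussianPDF (c * z.1) (d ^ 2).toNNReal z.2 := by
  have : IsProbabilityMeasure (P.map X) := Measure.isProbabilityMeasure_map hX.aemeasurable
  have hv : (d ^ 2).toNNReal ≠ 0 := (Real.toNNReal_pos.2 (by positivity)).ne'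
  have hpdf : Measurable fun z : ℝ × ℝ ↦ gaussianPDF (c * z.1) (d ^ 2).toNNReal z.2 :=
    measurable_uncurry_gaussianPDF.comp
      ((measurable_fst.const_mul c).prodMk (measurable_const.prodMk measurable_snd))
  have hjoint := (indepFun_iff_map_prod_eq_prod_map_map hX.aemeasurable hε.aemeasurable).1 hindep
  rw [hεlaw] at hjoint
  have hnoise (a : ℝ) : (gaussianReal 0 1).map (fun e ↦ c * a + d * e)
      = gaussianReal (c * a) (d ^ 2).toNNReal := by
    have h := gaussianReal_map_const_mul (μ := 0) (v := 1) d
    have h' := congrArg (Measure.map (fun y ↦ c * a + y)) h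
    rw [Measure.map_map (by fun_prop) (by fun_prop), gaussianReal_map_const_add] at h'
    refine h'.trans ?_
    congr 1
    · simp
    · ext
      simp [sq_nonneg]
  have hg : Measurable fun z : ℝ × ℝ ↦ (z.1, c * z.1 + d * z.2) := by fun_prop
  have hcomp : P.map (fun ω ↦ (X ω, c * X ω + d * ε ω))
      = ((P.map X).prod (gaussianReal 0 1)).map fun z ↦ (z.1, c * z.1 + d * z.2) := by
    rw [← hjoint, Measure.map_map hg (hX.prodMk hε)]
    rfl
  refine Measure.ext_of_lintegral _ fun f hf ↦ ?_
  have hfg : Measurable fun z : ℝ × ℝ ↦ f (z.1, c * z.1 + d * z.2) := hf.comp hg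
  rw [hcomp, lintegral_map hf hg, lintegral_prod _ hfg.aemeasurable,
    lintegral_withDensity_eq_lintegral_mul _ hpdf hf,
    lintegral_prod _ (hpdf.mul hf).aemeasurable]
  refine lintegral_congr fun a ↦ ?_
  have hfa : Measurable fun x ↦ f (a, x) := hf.comp (by fun_prop)
  rw [← lintegral_map (f := fun x ↦ f (a, x)) hfa (g := fun e ↦ c * a + d * e) (by fun_prop),
    hnoise, gaussianReal_of_var_ne_zero _ hv,
    lintegral_withDensity_eq_lintegral_mul _ (measurable_gaussianPDF _ _) hfa]
  rfl

/-- Denoising score matching identity: the conditional expectation of the transition score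
`(s X₀ - Xₜ)/(s²σ²)` given `Xₜ` equals the marginal score `(log pₜ)'(Xₜ)`. -/
theorem condexp_transition_score_eq_marginal_score
    {Ω : Type*} [MeasurableSpace Ω] (P : Measure Ω) [IsProbabilityMeasure P]
    (s σ : ℝ) (hs : 0 < s) (hσ : 0 < σ)
    (X₀ ε : Ω → ℝ) (hX₀ : Measurable X₀) (hX₀int : Integrable X₀ P) (hε : Measurable ε)
    (hεlaw : Measure.map ε P = gaussianReal 0 1)
    (hindep : IndepFun X₀ ε P)
    (Xt : Ω → ℝ) (hXt : ∀ ω, Xt ω = s * X₀ ω + s * σ * ε ω)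
    (pt : ℝ → ℝ)
    (hpt : ∀ x, pt x = ∫ x₀, gaussianPDFReal (s * x₀) ((s ^ 2 * σ ^ 2).toNNReal) x
      ∂(Measure.map X₀ P)) :
    P[(fun ω => (s * X₀ ω - Xt ω) / (s ^ 2 * σ ^ 2)) |
        MeasurableSpace.comap Xt (by infer_instance)]
      =ᵐ[P] fun ω => deriv (fun x => Real.log (pt x)) (Xt ω) := by
  obtain rfl : Xt = fun ω ↦ s * X₀ ω + s * σ * ε ω := funext hXt
  obtain rfl : pt = fun x ↦ ∫ x₀, gaussianPDFReal (s * x₀) ((s ^ 2 * σ ^ 2).toNNReal) x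
      ∂(Measure.map X₀ P) := funext hpt
  set Xt : Ω → ℝ := fun ω ↦ s * X₀ ω + s * σ * ε ω with hXt_def
  have hXtm : Measurable Xt := by fun_prop
  set μ := P.map X₀
  have : IsProbabilityMeasure μ := Measure.isProbabilityMeasure_map hX₀.aemeasurable
  have hv0 : 0 < s ^ 2 * σ ^ 2 := by positivity
  have hjoint := map_prodMk_const_mul_add_gaussian hX₀ hε hεlaw hindep s (mul_pos hs hσ).ne'
  rw [mul_pow] at hjoint
  have hvr : ((s ^ 2 * σ ^ 2).toNNReal : ℝ) = s ^ 2 * σ ^ 2 := Real.coe_toNNReal _ hv0.le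
  have hv : (s ^ 2 * σ ^ 2).toNNReal ≠ 0 := (Real.toNNReal_pos.2 hv0).ne'
  set v := (s ^ 2 * σ ^ 2).toNNReal
  rw [← hvr]
  set score : ℝ → ℝ := deriv fun x ↦ Real.log (∫ a, gaussianPDFReal (s * a) v x ∂μ)
  have hscorem : Measurable score := measurable_deriv _
  have hmean : Measurable fun a : ℝ ↦ s * a := by fun_prop
  have hmul (x : ℝ) : score x * ∫ a, gaussianPDFReal (s * a) v x ∂μ
      = ∫ a, (s * a - x) / v * gaussianPDFReal (s * a) v x ∂μ :=
    deriv_log_integral_gaussianPDFReal_mul μ hmean hv x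
  have hpair : Measurable fun ω ↦ (X₀ ω, Xt ω) := hX₀.prodMk hXtm
  have hpdf : Measurable fun z : ℝ × ℝ ↦ gaussianPDF (s * z.1) v z.2 :=
    measurable_uncurry_gaussianPDF.comp
      ((measurable_fst.const_mul s).prodMk (measurable_const.prodMk measurable_snd))
  have hpdf_lt : ∀ᵐ z ∂(μ.prod volume), gaussianPDF (s * z.1) v z.2 < ⊤ :=
    ae_of_all _ fun _ ↦ gaussianPDF_lt_top
  have hintegrable_iff {f : ℝ × ℝ → ℝ} (hf : Measurable f) :
      Integrable (fun ω ↦ f (X₀ ω, Xt ω)) P ↔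
        Integrable (fun z ↦ f z * gaussianPDFReal (s * z.1) v z.2) (μ.prod volume) := by
    have h := integrable_map_measure (μ := P) (f := fun ω ↦ (X₀ ω, Xt ω)) (g := f)
      hf.aestronglyMeasurable hpair.aemeasurable
    rw [hjoint, integrable_withDensity_iff hpdf hpdf_lt] at h
    simp only [toReal_gaussianPDF] at h
    exact h.symm
  have hsetIntegral {f : ℝ × ℝ → ℝ} (hf : Measurable f)
      (hfi : Integrable (fun ω ↦ f (X₀ ω, Xt ω)) P) {B : Set ℝ} (hB : MeasurableSet B) :
      ∫ ω in Xt ⁻¹' B, f (X₀ ω, Xt ω) ∂P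
        = ∫ x in B, ∫ a, f (a, x) * gaussianPDFReal (s * a) v x ∂μ := by
    have hS : MeasurableSet (Set.univ ×ˢ B : Set (ℝ × ℝ)) := MeasurableSet.univ.prod hB
    have h := setIntegral_map (μ := P) (g := fun ω ↦ (X₀ ω, Xt ω)) hS
      (f := f) hf.aestronglyMeasurable hpair.aemeasurable
    rw [hjoint, setIntegral_withDensity_eq_setIntegral_toReal_smul hpdf
      (ae_restrict_of_ae hpdf_lt) _ hS] at h
    simp only [toReal_gaussianPDF, smul_eq_mul] at h
    have hpre : (fun ω ↦ (X₀ ω, Xt ω)) ⁻¹' (Set.univ ×ˢ B) = Xt ⁻¹' B := by ext; simp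
    rw [hpre] at h
    rw [← h, ← Measure.prod_restrict, Measure.restrict_univ, integral_prod_symm]
    · simp only [mul_comm]
    · have := ((hintegrable_iff hf).1 hfi).mono_measure
        (Measure.prod_mono le_rfl (Measure.restrict_le_self (s := B)) :
          μ.prod (volume.restrict B) ≤ μ.prod volume)
      simpa only [mul_comm] using this
  have hcond_int : Integrable (fun ω ↦ (s * X₀ ω - Xt ω) / v) P := by
    have hεint : Integrable ε P := by
      have h : Integrable id (gaussianReal 0 1) := (memLp_id_gaussianReal 1).integrable le_rfl
      rw [← hεlaw] at h
      exact h.comp_measurable hε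
    refine (hεint.const_mul (-(s * σ) / v)).congr (ae_of_all _ fun ω ↦ ?_)
    simp only [hXt_def]
    ring
  have hcondm : Measurable fun z : ℝ × ℝ ↦ (s * z.1 - z.2) / v := by fun_prop
  have hcond_prod := (hintegrable_iff hcondm).1 hcond_int
  have hpdfReal : Measurable fun z : ℝ × ℝ ↦ gaussianPDFReal (s * z.1) v z.2 :=
    measurable_uncurry_gaussianPDFReal.comp
      ((measurable_fst.const_mul s).prodMk (measurable_const.prodMk measurable_snd))
  have hscorem' : Measurable fun z : ℝ × ℝ ↦ score z.2 := hscorem.comp measurable_snd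
  have hscore_int : Integrable (fun ω ↦ score (Xt ω)) P := by
    refine (hintegrable_iff hscorem').2 ((integrable_prod_iff'
      (hscorem'.mul hpdfReal).aestronglyMeasurable).2 ⟨ae_of_all _ fun x ↦
        (integrable_gaussianPDFReal_mean μ hmean v x).const_mul (score x), ?_⟩)
    refine hcond_prod.integral_prod_right.norm.congr (ae_of_all _ fun x ↦ ?_)
    simp only [Pi.mul_apply, norm_mul, Real.norm_of_nonneg (gaussianPDFReal_nonneg _ _ _),
      integral_const_mul]
    rw [← hmul, norm_mul,
      Real.norm_of_nonneg (integral_nonneg fun a ↦ gaussianPDFReal_nonneg _ _ _)]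
  refine (ae_eq_condExp_of_forall_setIntegral_eq hXtm.comap_le hcond_int
    (fun _ _ _ ↦ hscore_int.integrableOn) ?_
    (hscorem.comp (comap_measurable Xt)).aestronglyMeasurable).symm
  rintro _ ⟨B, hB, rfl⟩ -
  rw [hsetIntegral hcondm hcond_int hB, hsetIntegral hscorem' hscore_int hB]
  refine integral_congr_ae (ae_of_all _ fun x ↦ ?_)
  simp only [integral_const_mul]
  exact hmul x
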